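/- arXiv:2411.19087 — 2 statements merged into one kernel-verified Lean document; each statement's English description precedes it below -/
import Mathlib

section
/- Let q be a prime power, m,k positive integers, n > k, r := min(k, n−k). Then the number of k×(n−k) matrices X over F_{q^m} such that the F_{q^m}-dimension of the space of homogeneous polynomials of degree q+1 in F_{q^m}[x_1,…,x_k] vanishing at every point of the F_q-span U of the columns of [I_k | X] is different from C(k−r, 2) is at most r · q^{m·k·(n−k) − (m−1)}; equivalently, for a uniformly random X, h_{q+1}(C) = C(k+q, q+1) − C(k−r, 2) with probability at least 1 − r/q^{m−1}. -/
open MvPolynomial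

/-- The `F_{q^m}`-space of homogeneous polynomials of degree `d` in `k` variables
vanishing at every point of `U`. -/
noncomputable def homogVanish (Fqm : Type) [Field Fqm] (k d : ℕ)
    (U : Set (Fin k → Fqm)) : Submodule Fqm (MvPolynomial (Fin k) Fqm) :=
  homogeneousSubmodule (Fin k) Fqm d ⊓
    ⨅ u ∈ U, LinearMap.ker (aeval (R := Fqm) u).toLinearMap

/-- The `F_q`-span of the columns of the matrix `G = [I_k | X]`. -/
noncomputable def colSpanG (Fq Fqm : Type) [Field Fq] [Field Fqm] [Algebra Fq Fqm]
    (k t : ℕ) (M : Matrix (Fin k) (Fin t) Fqm) : Submodule Fq (Fin k → Fqm) :=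
  Submodule.span Fq (Set.range (fun i : Fin k => (Pi.single i 1 : Fin k → Fqm)) ∪
    Set.range (fun j : Fin t => fun i => M i j))

/-- The polynomial `∑ a i j * x_i ^ p * x_j`. -/
noncomputable def frobForm {K : Type} [Field K] {k : ℕ} (p : ℕ) (a : Matrix (Fin k) (Fin k) K) :
    MvPolynomial (Fin k) K :=
  ∑ i, ∑ j, monomial (Finsupp.single i p + Finsupp.single j 1) (a i j)

/-- The matrix of coefficients of the monomials `x_i ^ p * x_j` in `f`. -/
noncomputable def frobCoeff {K : Type} [Field K] {k : ℕ} (p : ℕ) (f : MvPolynomial (Fin k) K) :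
    Matrix (Fin k) (Fin k) K :=
  Matrix.of fun i j => coeff (Finsupp.single i p + Finsupp.single j 1) f

section FrobForm

variable {K : Type} [Field K] {k p : ℕ}

lemma single_add_single_inj (hp : 1 < p) {i j i' j' : Fin k}
    (h : Finsupp.single i p + Finsupp.single j 1 = Finsupp.single i' p + Finsupp.single j' 1) :
    i = i' ∧ j = j' := by
  have hi : i = i' := by
    by_contra hne
    have := DFunLike.congr_fun h i
    simp only [Finsupp.add_apply, Finsupp.single_apply, if_true, if_neg (Ne.symm hne)] at this
    split_ifs at this <;> omega
  subst hi
  exact ⟨rfl, Finsupp.single_left_injective one_ne_zero (add_left_cancel h)⟩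

lemma coeff_frobForm (hp : 1 < p) (a : Matrix (Fin k) (Fin k) K) (i j : Fin k) :
    coeff (Finsupp.single i p + Finsupp.single j 1) (frobForm p a) = a i j := by
  simp only [frobForm, coeff_sum, coeff_monomial]
  rw [Finset.sum_eq_single i, Finset.sum_eq_single j]
  · simp
  · intro j' _ hj
    rw [if_neg fun h => hj (single_add_single_inj hp h).2]
  · simp
  · intro i' _ hi
    exact Finset.sum_eq_zero fun j' _ => if_neg fun h => hi (single_add_single_inj hp h).1
  · simp

lemma frobForm_isHomogeneous (a : Matrix (Fin k) (Fin k) K) :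
    (frobForm p a).IsHomogeneous (p + 1) := by
  refine IsHomogeneous.sum _ _ _ fun i _ => IsHomogeneous.sum _ _ _ fun j _ => ?_
  exact isHomogeneous_monomial _ (by simp [Finsupp.degree_single])

lemma eval_frobForm (a : Matrix (Fin k) (Fin k) K) (u : Fin k → K) :
    eval u (frobForm p a) = (fun i => u i ^ p) ⬝ᵥ (a.mulVec u) := by
  simp only [frobForm, map_sum, eval_monomial, dotProduct, Matrix.mulVec, Finset.mul_sum]
  refine Finset.sum_congr rfl fun i _ => Finset.sum_congr rfl fun j _ => ?_
  rw [Finsupp.prod_add_index' (by simp) (by intros; simp [pow_add]),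
    Finsupp.prod_single_index (by simp), Finsupp.prod_single_index (by simp)]
  ring

/-- A form of degree `p + 1` without `x_i ^ (p + 1)` terms differs from its `frobForm` part by a
polynomial of degree less than `p` in each variable. -/
lemma degreeOf_sub_frobForm_lt (hp : 1 < p) {f : MvPolynomial (Fin k) K}
    (hf : f.IsHomogeneous (p + 1)) (i : Fin k) :
    degreeOf i (f - frobForm p (frobCoeff p f)) < p := by
  rw [degreeOf_lt_iff (by omega)]
  intro d hd
  by_contra! hdi
  have hdeg : Finsupp.degree d = p + 1 := by
    have := (hf.sub (frobForm_isHomogeneous (frobCoeff p f))) (mem_support_iff.1 hd)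
    rwa [Finsupp.degree_eq_weight_one]
  obtain ⟨e, rfl⟩ : ∃ e, d = Finsupp.single i p + e :=
    ⟨d - Finsupp.single i p, (add_tsub_cancel_of_le (by simpa using hdi)).symm⟩
  have he : Finsupp.degree e = 1 := by
    simp only [map_add, Finsupp.degree_single] at hdeg
    omega
  obtain ⟨j, rfl⟩ := (Finsupp.sum_eq_one_iff e).1 he
  rw [mem_support_iff, coeff_sub, coeff_frobForm hp] at hd
  exact hd (sub_self _)

lemma eq_frobForm_of_vanish {F : Type} [Field F] [Fintype F] [Algebra F K]
    {f : MvPolynomial (Fin k) K} (hf : f.IsHomogeneous (Fintype.card F + 1))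
    (h0 : ∀ v : Fin k → F, eval (fun i => algebraMap F K (v i)) f = 0) :
    f = frobForm (Fintype.card F) (frobCoeff (Fintype.card F) f) := by
  classical
  have hp : 1 < Fintype.card F := Fintype.one_lt_card
  set p := Fintype.card F with hpdef
  set a := frobCoeff p f with ha
  have hlt := degreeOf_sub_frobForm_lt hp hf
  rw [← ha] at hlt
  set Q : MvPolynomial (Fin k) K := ∑ i, ∑ j, C (a i j) * (X i * X j) with hQ
  have hpow : ∀ x : F, algebraMap F K x ^ p = algebraMap F K x := fun x => by
    rw [← map_pow, hpdef, FiniteField.pow_card]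
  have hPQ : ∀ v : Fin k → F, eval (fun i => algebraMap F K (v i)) (frobForm p a) =
      eval (fun i => algebraMap F K (v i)) Q := fun v => by
    simp only [eval_frobForm, hQ, map_sum, map_mul, eval_C, eval_X, dotProduct, Matrix.mulVec,
      Finset.mul_sum, hpow]
    exact Finset.sum_congr rfl fun i _ => Finset.sum_congr rfl fun j _ => by ring
  have hdiag : ∀ i, a i i = 0 := fun i => by
    have h1 := h0 (Pi.single i 1)
    have hmono : f = monomial (Finsupp.single i (p + 1)) (a i i) +
      (f - monomial (Finsupp.single i (p + 1)) (a i i)) := by ring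
    rw [hmono, map_add, eval_monomial] at h1
    have h2 : eval (fun j => algebraMap F K ((Pi.single i 1 : Fin k → F) j))
        (f - monomial (Finsupp.single i (p + 1)) (a i i)) = 0 := by
      rw [eval_eq]
      refine Finset.sum_eq_zero fun d hd => ?_
      have hdeg : Finsupp.degree d = p + 1 := by
        have := (hf.sub (isHomogeneous_monomial (d := Finsupp.single i (p + 1)) (a i i)
          (by simp))) (mem_support_iff.1 hd)
        rwa [Finsupp.degree_eq_weight_one]
      obtain ⟨j, hj, hdj⟩ : ∃ j, j ≠ i ∧ d j ≠ 0 := by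
        by_contra! hcon
        have hd' : d = Finsupp.single i (p + 1) := by
          have : d = Finsupp.single i (d i) := by
            ext j
            by_cases hj : j = i
            · subst hj; simp
            · rw [hcon j hj, Finsupp.single_eq_of_ne hj]
          rw [this, Finsupp.degree_single] at hdeg
          rw [this, hdeg]
        rw [mem_support_iff, hd', coeff_sub, coeff_monomial, if_pos rfl] at hd
        exact hd (by rw [ha, sub_eq_zero]; simp [frobCoeff, Finsupp.single_add])
      refine mul_eq_zero_of_right _ (Finset.prod_eq_zero (Finsupp.mem_support_iff.2 hdj) ?_)
      simp [hj, hdj]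
    rw [h2, add_zero, Finsupp.prod_single_index (by simp)] at h1
    simpa using h1
  have hQdeg : ∀ i, degreeOf i Q < p := fun l => by
    refine lt_of_le_of_lt ?_ hp
    refine (degreeOf_sum_le _ _ _).trans (Finset.sup_le fun i _ => ?_)
    refine (degreeOf_sum_le _ _ _).trans (Finset.sup_le fun j _ => ?_)
    by_cases hij : i = j
    · subst hij; simp [hdiag]
    · refine (degreeOf_C_mul_le _ _ _).trans ((degreeOf_mul_le _ _ _).trans ?_)
      rw [degreeOf_X, degreeOf_X]
      split_ifs with h1 h2 <;> omega
  have hzero : f - frobForm p a + Q = 0 := by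
    refine eq_zero_of_eval_zero_at_prod_finset _
      (fun _ => Finset.univ.image (algebraMap F K)) (fun i => ?_) (fun x hx => ?_)
    · rw [Finset.card_image_of_injective _ (algebraMap F K).injective, Finset.card_univ]
      exact (degreeOf_add_le _ _ _).trans_lt (max_lt (hlt i) (hQdeg i))
    · choose v hv using fun i => Finset.mem_image.1 (hx i)
      obtain rfl : (fun i => algebraMap F K (v i)) = x := funext fun i => (hv i).2
      rw [map_add, map_sub, h0, hPQ]
      ring
  have hQhom : Q.IsHomogeneous 2 :=
    IsHomogeneous.sum _ _ _ fun i _ => IsHomogeneous.sum _ _ _ fun j _ => by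
      simpa using (isHomogeneous_C _ (a i j)).mul ((isHomogeneous_X K i).mul (isHomogeneous_X K j))
  by_contra hne
  have h1 : f - frobForm p a ≠ 0 := sub_ne_zero.2 hne
  have h2 := IsHomogeneous.inj_right (hf.sub (frobForm_isHomogeneous a))
    (by rw [eq_neg_of_add_eq_zero_left hzero]; exact hQhom.neg) h1
  omega

end FrobForm

section Skew

variable {K : Type} [Field K] {k : ℕ} {a : Matrix (Fin k) (Fin k) K}

lemma dotProduct_mulVec_self_eq_zero (hdiag : ∀ i, a i i = 0) (hskew : a.transpose = -a)
    (x : Fin k → K) : x ⬝ᵥ a.mulVec x = 0 := by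
  simp only [dotProduct, Matrix.mulVec, Finset.mul_sum]
  rw [← Finset.sum_product']
  refine Finset.sum_involution (fun ij _ => ij.swap) ?_ ?_ (by simp) (by simp)
  · rintro ⟨i, j⟩ -
    have : a j i = -a i j := congrFun (congrFun hskew i) j
    simp only [Prod.swap, this]
    ring
  · rintro ⟨i, j⟩ - hne heq
    obtain rfl : j = i := congrArg Prod.fst heq
    simp [hdiag] at hne

/-- The alternating form with a given alternating Gram matrix. -/
noncomputable def alternatingOfMatrix (hdiag : ∀ i, a i i = 0) (hskew : a.transpose = -a) :
    (Fin k → K) [⋀^Fin 2]→ₗ[K] K where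
  toFun v := v 0 ⬝ᵥ a.mulVec (v 1)
  map_update_add' v i x y := by
    fin_cases i <;> simp [Matrix.mulVec_add]
  map_update_smul' v i c x := by
    fin_cases i <;> simp [Matrix.mulVec_smul]
  map_eq_zero_of_eq' v i j hv hij := by
    have h : v 0 = v 1 := by
      fin_cases i <;> fin_cases j <;> simp_all
    rw [h, dotProduct_mulVec_self_eq_zero hdiag hskew]

/-- The Gram matrix of the pullback to `K^k` of an alternating form on a quotient of `K^k`. -/
noncomputable def gramMatrix (W : Submodule K (Fin k → K))
    (ω : ((Fin k → K) ⧸ W) [⋀^Fin 2]→ₗ[K] K) : Matrix (Fin k) (Fin k) K :=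
  Matrix.of fun i j => ω ![W.mkQ (Pi.single i 1), W.mkQ (Pi.single j 1)]

variable {W : Submodule K (Fin k → K)}

lemma gramMatrix_diag (ω : ((Fin k → K) ⧸ W) [⋀^Fin 2]→ₗ[K] K) (i : Fin k) :
    gramMatrix W ω i i = 0 :=
  ω.map_eq_zero_of_eq _ (i := 0) (j := 1) (by simp) (by simp)

lemma gramMatrix_transpose (ω : ((Fin k → K) ⧸ W) [⋀^Fin 2]→ₗ[K] K) :
    (gramMatrix W ω).transpose = -gramMatrix W ω := by
  ext i j
  have h := ω.map_swap ![W.mkQ (Pi.single i 1), W.mkQ (Pi.single j 1)]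
    (i := 0) (j := 1) (by simp)
  simp only [Matrix.transpose_apply, Matrix.neg_apply, gramMatrix, Matrix.of_apply]
  rw [← h]
  congr 1
  ext l
  fin_cases l <;> simp

lemma gramMatrix_mulVec (ω : ((Fin k → K) ⧸ W) [⋀^Fin 2]→ₗ[K] K) (v : Fin k → K) (i : Fin k) :
    (gramMatrix W ω).mulVec v i = ω ![W.mkQ (Pi.single i 1), W.mkQ v] := by
  have hupd : ∀ x y : (Fin k → K) ⧸ W, Function.update ![x, 0] 1 y = ![x, y] := fun x y => by
    ext l
    fin_cases l <;> simp
  let L : (Fin k → K) →ₗ[K] K :=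
    (ω.toMultilinearMap.toLinearMap ![W.mkQ (Pi.single i 1), 0] 1) ∘ₗ W.mkQ
  have hL : ∀ v, L v = ω ![W.mkQ (Pi.single i 1), W.mkQ v] := fun v => by
    simp only [L, LinearMap.comp_apply, MultilinearMap.toLinearMap_apply, hupd]
    rfl
  rw [← hL, LinearMap.pi_apply_eq_sum_univ L v, Matrix.mulVec, dotProduct]
  refine Finset.sum_congr rfl fun j _ => ?_
  have : (fun l => if j = l then (1 : K) else 0) = Pi.single j 1 := by
    ext l
    simp [Pi.single_apply, eq_comm]
  rw [this, hL, smul_eq_mul, mul_comm]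
  rfl

lemma gramMatrix_mulVec_eq_zero (ω : ((Fin k → K) ⧸ W) [⋀^Fin 2]→ₗ[K] K) {w : Fin k → K}
    (hw : w ∈ W) : (gramMatrix W ω).mulVec w = 0 := by
  ext i
  have h : W.mkQ w = 0 := by simpa using hw
  rw [gramMatrix_mulVec, h]
  exact ω.map_coord_zero (m := ![W.mkQ (Pi.single i 1), 0]) 1 rfl

lemma gramMatrix_injective {ω : ((Fin k → K) ⧸ W) [⋀^Fin 2]→ₗ[K] K} (h : gramMatrix W ω = 0) :
    ω = 0 := by
  apply AlternatingMap.compLinearMap_injective W.mkQ W.mkQ_surjective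
  refine (Pi.basisFun K (Fin k)).ext_alternating fun v _ => ?_
  have h1 := congrFun (congrFun h (v 0)) (v 1)
  simp only [gramMatrix, Matrix.of_apply, Matrix.zero_apply] at h1
  simp only [AlternatingMap.compLinearMap_apply, AlternatingMap.zero_apply, Pi.basisFun_apply]
  rw [← h1]
  congr 1
  ext l
  fin_cases l <;> rfl

lemma exists_gramMatrix_eq (hdiag : ∀ i, a i i = 0) (hskew : a.transpose = -a)
    (hW : ∀ w ∈ W, a.mulVec w = 0) : ∃ ω, gramMatrix W ω = a := by
  obtain ⟨s, hs⟩ := LinearMap.exists_rightInverse_of_surjective W.mkQ W.range_mkQ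
  refine ⟨(alternatingOfMatrix hdiag hskew).compLinearMap s, ?_⟩
  have hsv : ∀ v, a.mulVec (s (W.mkQ v)) = a.mulVec v := fun v => by
    rw [← sub_eq_zero, ← Matrix.mulVec_sub]
    apply hW
    refine (Submodule.Quotient.mk_eq_zero W).1 ?_
    change W.mkQ _ = 0
    rw [map_sub, sub_eq_zero]
    exact LinearMap.congr_fun hs _
  ext i j
  change s (W.mkQ (Pi.single i 1)) ⬝ᵥ a.mulVec (s (W.mkQ (Pi.single j 1))) = a i j
  rw [hsv, Matrix.dotProduct_mulVec, ← Matrix.mulVec_transpose, hskew, Matrix.neg_mulVec, hsv,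
    ← Matrix.neg_mulVec, ← hskew]
  simp

end Skew

section Vanishing

lemma mem_homogVanish {K : Type} [Field K] {k d : ℕ} {U : Set (Fin k → K)} {f : MvPolynomial (Fin k) K} :
    f ∈ homogVanish K k d U ↔ f.IsHomogeneous d ∧ ∀ u ∈ U, eval u f = 0 := by
  simp [homogVanish, Submodule.mem_inf, Submodule.mem_iInf, aeval_eq_eval]

lemma single_mem_colSpanG {F K : Type} [Field F] [Field K] [Algebra F K] {k t : ℕ}
    (M : Matrix (Fin k) (Fin t) K) (i : Fin k) :
    Pi.single i 1 ∈ colSpanG F K k t M :=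
  Submodule.subset_span (Or.inl ⟨i, rfl⟩)

lemma algebraMap_mem_colSpanG {F K : Type} [Field F] [Field K] [Algebra F K] {k t : ℕ}
    (M : Matrix (Fin k) (Fin t) K) (v : Fin k → F) :
    (fun i => algebraMap F K (v i)) ∈ colSpanG F K k t M := by
  have : (fun i => algebraMap F K (v i)) = ∑ i, v i • (Pi.single i 1 : Fin k → K) := by
    ext j
    simp [Finset.sum_apply, Pi.single_apply, Algebra.algebraMap_eq_smul_one]
  rw [this]
  exact Submodule.sum_mem _ fun i _ => Submodule.smul_mem _ _ (single_mem_colSpanG M i)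

lemma single_pow_card {F K : Type} [Fintype F] [Nonempty F] [Field K] {k : ℕ} (i : Fin k) :
    (fun j => (Pi.single i 1 : Fin k → K) j ^ Fintype.card F) = Pi.single i 1 := by
  ext j
  by_cases h : j = i
  · subst h; simp
  · simp [Pi.single_eq_of_ne h, Fintype.card_ne_zero]

variable {F K : Type} [Field F] [Fintype F] [Field K] [Algebra F K] {k t : ℕ}

/-- The matrix with entries `x - x ^ q`, for `q` the order of `F`. -/
def subFrob (F : Type) {K : Type} [Fintype F] [Field K] {k t : ℕ} (M : Matrix (Fin k) (Fin t) K) : Matrix (Fin k) (Fin t) K :=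
  M.map fun x => x - x ^ Fintype.card F

lemma eval_frobForm_add (a : Matrix (Fin k) (Fin k) K) (u v : Fin k → K) :
    eval (u + v) (frobForm (Fintype.card F) a) =
      eval u (frobForm (Fintype.card F) a) + eval v (frobForm (Fintype.card F) a) +
      (fun i => u i ^ Fintype.card F) ⬝ᵥ a.mulVec v +
      (fun i => v i ^ Fintype.card F) ⬝ᵥ a.mulVec u := by
  have h : (fun i => (u + v) i ^ Fintype.card F) =
      (fun i => u i ^ Fintype.card F) + fun i => v i ^ Fintype.card F := by
    ext i
    simpa [FiniteField.coe_frobeniusAlgHom] using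
      map_add (FiniteField.frobeniusAlgHom F K) (u i) (v i)
  simp only [eval_frobForm, h, Matrix.mulVec_add, add_dotProduct, dotProduct_add]
  ring

/-- A form of degree `q + 1` vanishing on the `F`-span of the columns of `[I | M]` comes from
an alternating matrix annihilating `subFrob F M`. -/
lemma frobCoeff_of_mem_homogVanish {M : Matrix (Fin k) (Fin t) K} {f : MvPolynomial (Fin k) K}
    (hf : f ∈ homogVanish K k (Fintype.card F + 1) (colSpanG F K k t M : Set (Fin k → K))) :
    ∃ a : Matrix (Fin k) (Fin k) K, f = frobForm (Fintype.card F) a ∧ (∀ i, a i i = 0) ∧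
      a.transpose = -a ∧ a * subFrob F M = 0 := by
  obtain ⟨hom, hU⟩ := mem_homogVanish.1 hf
  refine ⟨frobCoeff (Fintype.card F) f,
    eq_frobForm_of_vanish hom fun v => hU _ (algebraMap_mem_colSpanG M v), ?_⟩
  have hfa := eq_frobForm_of_vanish hom fun v => hU _ (algebraMap_mem_colSpanG M v)
  generalize frobCoeff (Fintype.card F) f = a at hfa
  subst hfa
  have hadd : ∀ u ∈ colSpanG F K k t M, ∀ v ∈ colSpanG F K k t M,
      (fun i => u i ^ Fintype.card F) ⬝ᵥ a.mulVec v +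
      (fun i => v i ^ Fintype.card F) ⬝ᵥ a.mulVec u = 0 := fun u hu v hv => by
    have h := hU _ (Submodule.add_mem _ hu hv)
    rwa [eval_frobForm_add, hU u hu, hU v hv, add_zero, zero_add] at h
  have hskew : a.transpose = -a := by
    ext i j
    have h := hadd _ (single_mem_colSpanG M i) _ (single_mem_colSpanG M j)
    simp only [single_pow_card] at h
    simp only [single_dotProduct, Matrix.mulVec_single_one, Matrix.col_apply, one_mul] at h
    simpa using eq_neg_of_add_eq_zero_right h
  refine ⟨fun i => ?_, hskew, ?_⟩
  · have h := hU _ (single_mem_colSpanG M i)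
    rw [eval_frobForm, single_pow_card] at h
    simpa using h
  · ext i l
    have h := hadd _ (single_mem_colSpanG M i) (M.col l)
      (Submodule.subset_span (Or.inr ⟨l, rfl⟩))
    rw [single_pow_card, single_dotProduct, one_mul, Matrix.dotProduct_mulVec,
      ← Matrix.mulVec_transpose, hskew, Matrix.neg_mulVec, neg_dotProduct, dotProduct_single,
      mul_one, ← sub_eq_add_neg] at h
    simp only [Matrix.mul_apply, subFrob, Matrix.map_apply, mul_sub, Finset.sum_sub_distrib]
    exact h

lemma frobForm_mem_homogVanish {M : Matrix (Fin k) (Fin t) K} {a : Matrix (Fin k) (Fin k) K}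
    (hdiag : ∀ i, a i i = 0) (hskew : a.transpose = -a) (hM : a * subFrob F M = 0) :
    frobForm (Fintype.card F) a ∈
      homogVanish K k (Fintype.card F + 1) (colSpanG F K k t M : Set (Fin k → K)) := by
  refine mem_homogVanish.2 ⟨frobForm_isHomogeneous a, fun u hu => ?_⟩
  have key : a.mulVec u = a.mulVec fun i => u i ^ Fintype.card F := by
    refine Submodule.span_induction (p := fun u _ =>
      a.mulVec u = a.mulVec fun i => u i ^ Fintype.card F) ?_ ?_ ?_ ?_ hu
    · rintro _ (⟨i, rfl⟩ | ⟨l, rfl⟩)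
      · simp only [single_pow_card]
      · ext i
        have h := congrFun (congrFun hM i) l
        simp only [Matrix.mul_apply, subFrob, Matrix.map_apply, mul_sub,
          Finset.sum_sub_distrib, Matrix.zero_apply] at h
        exact sub_eq_zero.1 h
    · congr 1
      ext i
      simp [Fintype.card_ne_zero]
    · intro u v _ _ hu hv
      rw [Matrix.mulVec_add, hu, hv, ← Matrix.mulVec_add]
      congr 1
      ext i
      simpa [FiniteField.coe_frobeniusAlgHom] using
        (map_add (FiniteField.frobeniusAlgHom F K) (u i) (v i)).symm
    · intro c u _ hu
      rw [Matrix.mulVec_smul, hu, ← Matrix.mulVec_smul]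
      congr 1
      ext i
      have h := map_smul (FiniteField.frobeniusAlgHom F K) c (u i)
      simp only [FiniteField.coe_frobeniusAlgHom] at h
      exact h.symm
  rw [eval_frobForm, key, dotProduct_mulVec_self_eq_zero hdiag hskew]

theorem finrank_homogVanish (M : Matrix (Fin k) (Fin t) K) :
    Module.finrank K
      (homogVanish K k (Fintype.card F + 1) (colSpanG F K k t M : Set (Fin k → K))) =
      (k - (subFrob F M).rank).choose 2 := by
  set W := LinearMap.range (subFrob F M).mulVecLin with hW
  let Φ : ((Fin k → K) ⧸ W) [⋀^Fin 2]→ₗ[K] K →ₗ[K] MvPolynomial (Fin k) K :=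
    { toFun := fun ω => frobForm (Fintype.card F) (gramMatrix W ω)
      map_add' := fun ω η => by
        simp [frobForm, gramMatrix, Finset.sum_add_distrib]
      map_smul' := fun c ω => by
        simp [frobForm, gramMatrix, Finset.smul_sum, smul_monomial] }
  have hΦ : ∀ ω, Φ ω = frobForm (Fintype.card F) (gramMatrix W ω) := fun ω => rfl
  have hinj : Function.Injective Φ := by
    refine (injective_iff_map_eq_zero Φ).2 fun ω h => gramMatrix_injective ?_
    ext i j
    rw [← coeff_frobForm (Fintype.one_lt_card (α := F)) (gramMatrix W ω) i j, ← hΦ, h]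
    simp
  have hrange : LinearMap.range Φ =
      homogVanish K k (Fintype.card F + 1) (colSpanG F K k t M : Set (Fin k → K)) := by
    apply le_antisymm
    · rintro _ ⟨ω, rfl⟩
      refine frobForm_mem_homogVanish (gramMatrix_diag ω) (gramMatrix_transpose ω) ?_
      ext i l
      have h := gramMatrix_mulVec_eq_zero ω (w := (subFrob F M).col l)
        ⟨Pi.single l 1, by simp⟩
      exact congrFun h i
    · intro f hf
      obtain ⟨a, rfl, hdiag, hskew, hM⟩ := frobCoeff_of_mem_homogVanish hf
      obtain ⟨ω, rfl⟩ := exists_gramMatrix_eq (W := W) hdiag hskew (by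
        rintro _ ⟨z, rfl⟩
        rw [Matrix.mulVecLin_apply, Matrix.mulVec_mulVec, hM, Matrix.zero_mulVec])
      exact ⟨ω, rfl⟩
  rw [← hrange, LinearMap.finrank_range_of_inj hinj,
    (exteriorPower.alternatingMapLinearEquiv).finrank_eq, Subspace.dual_finrank_eq,
    exteriorPower.finrank_eq, Submodule.finrank_quotient, Module.finrank_fin_fun]
  rfl

end Vanishing

section Counting

variable {K : Type} [Field K] {r : ℕ}

/-- The generic `r × r` minor `det (x_ij - x_ij ^ p)`, in variables indexed by a type into which
the index pairs are mapped by `e`. -/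
noncomputable def frobMinor (K : Type) [Field K] {N r : ℕ} (p : ℕ) (e : Fin r × Fin r → Fin N) :
    MvPolynomial (Fin N) K :=
  (Matrix.of fun i j => X (e (i, j)) - X (e (i, j)) ^ p).det

lemma eval_frobMinor {N : ℕ} (p : ℕ) (e : Fin r × Fin r → Fin N) (x : Fin N → K) :
    eval x (frobMinor K p e) = (Matrix.of fun i j => x (e (i, j)) - x (e (i, j)) ^ p).det := by
  rw [frobMinor, RingHom.map_det]
  congr 1
  ext i j
  simp

lemma frobMinor_ne_zero {N p : ℕ} (hp : 1 < p) {e : Fin r × Fin r → Fin N}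
    (he : Function.Injective e) : frobMinor K p e ≠ 0 := by
  classical
  intro h
  let φ : MvPolynomial (Fin N) K →ₐ[K] Polynomial K :=
    aeval fun n => if ∃ i, e (i, i) = n then Polynomial.X else 0
  have h1 : φ (frobMinor K p e) =
      (Matrix.diagonal fun _ : Fin r => (Polynomial.X - Polynomial.X ^ p : Polynomial K)).det := by
    rw [frobMinor, AlgHom.map_det]
    congr 1
    ext1 i j
    have hiff : (∃ l, e (l, l) = e (i, j)) ↔ i = j := by
      constructor
      · rintro ⟨l, hl⟩
        have := he hl
        simp only [Prod.mk.injEq] at this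
        exact this.1.symm.trans this.2
      · rintro rfl
        exact ⟨i, rfl⟩
    simp only [AlgHom.mapMatrix_apply, Matrix.map_apply, Matrix.of_apply, map_sub, map_pow, φ,
      aeval_X, hiff, Matrix.diagonal_apply]
    split_ifs
    · rfl
    · rw [zero_pow (by omega), sub_zero]
  rw [h, map_zero, Matrix.det_diagonal, Finset.prod_const] at h1
  have h2 := congrArg (Polynomial.coeff · 1) (eq_zero_of_pow_eq_zero h1.symm)
  simp [Polynomial.coeff_X_pow, hp.ne] at h2

lemma totalDegree_frobMinor_le {N p : ℕ} (hp : 1 < p) (e : Fin r × Fin r → Fin N) :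
    (frobMinor K p e).totalDegree ≤ r * p := by
  rw [frobMinor, Matrix.det_apply]
  refine totalDegree_finsetSum_le fun σ _ => ?_
  refine (totalDegree_smul_le _ _).trans ((totalDegree_finsetProd _ _).trans ?_)
  refine (Finset.sum_le_card_nsmul _ _ p fun i _ => ?_).trans (by simp)
  refine (totalDegree_sub _ _).trans (max_le ?_ ?_)
  · rw [totalDegree_X]; omega
  · rw [totalDegree_X_pow]

end Counting

theorem statement_10
    (q m k n : ℕ) (hqp : IsPrimePow q) (hm : 0 < m) (hk : 0 < k) (hn : k < n)
    (Fq Fqm : Type) [Field Fq] [Fintype Fq] [Field Fqm] [Fintype Fqm] [Algebra Fq Fqm]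
    (hq : Fintype.card Fq = q) (hqm : Fintype.card Fqm = q ^ m)
    (hdeg : Module.finrank Fq Fqm = m)
    (r : ℕ) (hr : r = min k (n - k)) :
    Nat.card {X : Matrix (Fin k) (Fin (n - k)) Fqm |
        Module.finrank Fqm
            ↥(homogVanish Fqm k (q + 1) (colSpanG Fq Fqm k (n - k) X : Set (Fin k → Fqm)))
          ≠ Nat.choose (k - r) 2}
      ≤ r * q ^ (m * k * (n - k) - (m - 1)) := by
  classical
  subst hq
  set q := Fintype.card Fq with hq
  set t := n - k with ht
  have hq1 : 1 < q := Fintype.one_lt_card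
  let ι : Fin r × Fin r → Fin k × Fin t :=
    Prod.map (Fin.castLE (hr ▸ min_le_left _ _)) (Fin.castLE (hr ▸ min_le_right _ _))
  let e : Fin r × Fin r → Fin (k * t) := finProdFinEquiv ∘ ι
  have he : Function.Injective e := finProdFinEquiv.injective.comp
    ((Fin.castLE_injective _).prodMap (Fin.castLE_injective _))
  have hgood : ∀ M : Matrix (Fin k) (Fin t) Fqm,
      eval (fun l => M (finProdFinEquiv.symm l).1 (finProdFinEquiv.symm l).2)
        (frobMinor Fqm q e) ≠ 0 →
      Module.finrank Fqm ↥(homogVanish Fqm k (q + 1)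
        (colSpanG Fq Fqm k t M : Set (Fin k → Fqm))) = Nat.choose (k - r) 2 := by
    intro M hM
    rw [eval_frobMinor] at hM
    have hM' : ((subFrob Fq M).submatrix (fun i : Fin r => (ι (i, i)).1)
        (fun j : Fin r => (ι (j, j)).2)).det ≠ 0 := by
      convert hM using 2
      ext i j
      simp [subFrob, e, ι, hq]
    rw [finrank_homogVanish]
    congr 2
    apply le_antisymm
    · rw [hr]
      exact le_min (Matrix.rank_le_height _) (Matrix.rank_le_width _)
    · simpa [Matrix.rank_of_det_ne_zero hM'] using
        Matrix.rank_submatrix_le (subFrob Fq M) (fun i : Fin r => (ι (i, i)).1)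
          (fun j : Fin r => (ι (j, j)).2)
  set Z : Finset (Fin (k * t) → Fqm) :=
    {f ∈ Fintype.piFinset fun _ => Finset.univ | eval f (frobMinor Fqm q e) = 0} with hZ
  have hcard : Nat.card {X : Matrix (Fin k) (Fin t) Fqm |
        Module.finrank Fqm
            ↥(homogVanish Fqm k (q + 1) (colSpanG Fq Fqm k t X : Set (Fin k → Fqm)))
          ≠ Nat.choose (k - r) 2} ≤ Z.card := by
    rw [← Nat.card_eq_finsetCard]
    refine Nat.card_le_card_of_injective (fun M => ⟨fun l =>
      M.1 (finProdFinEquiv.symm l).1 (finProdFinEquiv.symm l).2, ?_⟩) ?_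
    · simp only [hZ, Finset.mem_filter, Fintype.mem_piFinset, Finset.mem_univ, implies_true,
        true_and]
      by_contra hne
      exact M.2 (hgood M.1 hne)
    · intro M M' h
      ext i j
      simpa using congrFun (congrArg Subtype.val h) (finProdFinEquiv (i, j))
  have hSZ := schwartz_zippel_totalDegree (frobMinor_ne_zero (K := Fqm) hq1 he) Finset.univ
  rw [← hZ, Finset.card_univ, hqm, div_le_div_iff₀ (by positivity) (by positivity)] at hSZ
  have hSZ' : Z.card * q ^ m ≤ (frobMinor Fqm q e).totalDegree * (q ^ m) ^ (k * t) := by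
    exact_mod_cast hSZ
  refine hcard.trans (Nat.le_of_mul_le_mul_right ?_ (by positivity : 0 < q ^ m))
  refine hSZ'.trans ((Nat.mul_le_mul_right _ (totalDegree_frobMinor_le hq1 e)).trans_eq ?_)
  have hle : m - 1 ≤ m * k * t := by
    have : 0 < k * t := Nat.mul_pos hk (by omega)
    nlinarith [Nat.sub_le m 1]
  rw [mul_assoc, mul_assoc, ← pow_mul, ← pow_succ', ← pow_add]
  congr 2
  rw [← mul_assoc]
  omega
end

section
/- Let q be a prime power, m,k positive integers with k ≥ 2, s ∈ {1,…,m−1} with gcd(s,m) = δ, and let p ∈ F_s be a nonzero form. Define Z̃_p := { α^{[s]} − α : α ∈ F_{q^m}^k and p vanishes on α + F_{q^δ}^k } ⊆ F_{q^m}^k. If the F_{q^m}-dimension of the F_{q^m}-span of Z̃_p equals r, then there exist α_1,…,α_r ∈ F_{q^m}^k such that (q^δ)^{Σ_{i=1}^{r} dim_{F_{q^δ}} H_{α_i}} ≤ |Z̃_p| ≤ q^{r(m−δ)}, where H_{α_i} := { v ∈ F_{q^m} : Tr_{F_{q^m}/F_{q^δ}}((α_{i,j}^{[s]} − α_{i,j})·v)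 = 0 for all j ∈ {1,…,k} }; in particular |Z̃_p| ≤ q^{(k−2)(m−δ)}. -/
open MvPolynomial

/-- The space `F_s`: the `F_{q^m}`-span of the forms `x_i^Q x_j - x_i x_j^Q` for `i < j`,
where `Q = q^s`. -/
noncomputable def formSpace (Fqm : Type) [Field Fqm] (k Q : ℕ) :
    Submodule Fqm (MvPolynomial (Fin k) Fqm) :=
  Submodule.span Fqm {p | ∃ i j : Fin k, i < j ∧
    p = X i ^ Q * X j - X i * X j ^ Q}

/-- The coset `α + F₀^k` inside `F^k`, where `F₀` is a subfield of `F`. -/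
def coset (F₀ F : Type) [Field F₀] [Field F] [Algebra F₀ F] {k : ℕ}
    (α : Fin k → F) : Set (Fin k → F) :=
  {v | ∃ a : Fin k → F₀, v = α + fun i => algebraMap F₀ F (a i)}

/-- The set `Z̃_p` of vectors `α^{[s]} - α`, for `α` ranging over the vectors whose coset
`α + F₀^k` is contained in the zero locus of `p`. -/
def Ztilde (F₀ F : Type) [Field F₀] [Field F] [Algebra F₀ F] {k : ℕ}
    (Q : ℕ) (p : MvPolynomial (Fin k) F) : Set (Fin k → F) :=
  {w | ∃ α : Fin k → F, (∀ v ∈ coset F₀ F α, eval v p = 0) ∧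
    w = fun j => α j ^ Q - α j}

/-- The subspace `H_α = {v ∈ F : Tr_{F/F₀}((α_j^{[s]} - α_j)·v) = 0 for all j}`. -/
noncomputable def traceKer (F₀ F : Type) [Field F₀] [Field F] [Algebra F₀ F]
    {k : ℕ} (Q : ℕ) (α : Fin k → F) : Submodule F₀ F :=
  ⨅ j : Fin k, LinearMap.ker
    ((Algebra.trace F₀ F) ∘ₗ (LinearMap.mulLeft F₀ (α j ^ Q - α j)))

section TraceKernel

variable {K F : Type*} [Field K] [Finite K] [Field F] [Algebra K F] [FiniteDimensional K F]

theorem FiniteField.finrank_ker_trace_add_one :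
    Module.finrank K (LinearMap.ker (Algebra.trace K F)) + 1 = Module.finrank K F := by
  have h := (Algebra.trace K F).finrank_range_add_finrank_ker
  rw [LinearMap.range_eq_top.2 (Algebra.trace_surjective K F), finrank_top,
    Module.finrank_self] at h
  omega

theorem FiniteField.mem_range_algebraMap_of_pow_card_eq {x : F} (hx : x ^ Nat.card K = x) :
    x ∈ Set.range (algebraMap K F) := by
  have := Fintype.ofFinite K
  have : Finite F := Module.finite_of_finite K
  rw [Nat.card_eq_fintype_card] at hx
  rw [IsGalois.mem_range_algebraMap_iff_fixed]
  intro g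
  obtain ⟨n, hn⟩ := (FiniteField.bijective_frobeniusAlgEquivOfAlgebraic_pow K F).2 g
  rw [← hn]
  simp only [AlgEquiv.coe_pow, FiniteField.coe_frobeniusAlgEquivOfAlgebraic]
  exact Function.iterate_fixed hx _

/-- An additive form of Hilbert's Theorem 90 over finite fields. -/
theorem FiniteField.range_sub_id_eq_ker_trace (σ : F ≃ₐ[K] F)
    (hσ : ∀ x, σ x = x → x ∈ Set.range (algebraMap K F)) :
    LinearMap.range (σ.toLinearMap - LinearMap.id) = LinearMap.ker (Algebra.trace K F) := by
  refine Submodule.eq_of_le_of_finrank_eq ?_ ?_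
  · rintro _ ⟨x, rfl⟩
    simp [Algebra.trace_eq_of_algEquiv]
  · have hker : Module.finrank K (LinearMap.ker (σ.toLinearMap - LinearMap.id)) = 1 := by
      refine finrank_eq_one_iff'.2 ⟨⟨1, by simp⟩, by simp [Subtype.ext_iff], ?_⟩
      rintro ⟨w, hw⟩
      obtain ⟨c, hc⟩ := hσ w (by simpa [sub_eq_zero] using hw)
      exact ⟨c, Subtype.ext (by simp [← hc, Algebra.algebraMap_eq_smul_one])⟩
    have h := (σ.toLinearMap - LinearMap.id).finrank_range_add_finrank_ker
    have := FiniteField.finrank_ker_trace_add_one (K := K) (F := F)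
    omega

end TraceKernel

section LinearAlgebra

variable {F : Type*} [Field F]

/-- A subspace of `ι → F` embeds into a product of at most `finrank F W` coordinates. -/
theorem Submodule.exists_coordinates_injOn {ι : Type*} [Finite ι] (W : Submodule F (ι → F)) :
    ∃ s : Set ι, Nat.card s ≤ Module.finrank F W ∧
      Set.InjOn (fun (w : ι → F) (i : s) => w i) W := by
  have := Fintype.ofFinite ι
  obtain ⟨κ, a, ha, hspan, hli⟩ := exists_linearIndependent' F
    (fun i : ι => (LinearMap.proj i : (ι → F) →ₗ[F] F) ∘ₗ W.subtype)
  have := Finite.of_injective a ha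
  have := Fintype.ofFinite κ
  refine ⟨Set.range a, ?_, ?_⟩
  · rw [Nat.card_range_of_injective ha, Nat.card_eq_fintype_card]
    exact hli.fintype_card_le_finrank.trans_eq Subspace.dual_finrank_eq
  · intro x hx y hy hxy
    funext i
    have key : ∀ f ∈ Submodule.span F
        (Set.range fun i : ι => (LinearMap.proj i : (ι → F) →ₗ[F] F) ∘ₗ W.subtype),
        f ⟨x, hx⟩ = f ⟨y, hy⟩ := by
      rw [← hspan]
      intro f hf
      induction hf using Submodule.span_induction with
      | mem f hf =>
        obtain ⟨j, rfl⟩ := hf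
        exact congrFun hxy ⟨a j, j, rfl⟩
      | zero => rfl
      | add f g _ _ hf hg => simp [hf, hg]
      | smul c f _ hf => simp [hf]
    exact key _ (Submodule.subset_span ⟨i, rfl⟩)

open Matrix in
theorem Matrix.finrank_ker_vecMulLinear_le_of_isAlt {ι : Type*} [Fintype ι]
    {C : Matrix ι ι F} (hC : C ≠ 0) (hdiag : ∀ i, C i i = 0) (hskew : ∀ i j, C i j = -C j i) :
    Module.finrank F (LinearMap.ker C.vecMulLinear) ≤ Fintype.card ι - 2 := by
  classical
  obtain ⟨i, j, hij⟩ : ∃ i j, C i j ≠ 0 := by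
    by_contra! h
    exact hC (Matrix.ext h)
  have hne : i ≠ j := by rintro rfl; exact hij (hdiag i)
  have hji : C j i ≠ 0 := by rw [hskew]; simpa using hij
  let f : LinearMap.ker C.vecMulLinear →ₗ[F] ({l // l ∈ ({i, j} : Finset ι)ᶜ} → F) :=
    LinearMap.funLeft F F Subtype.val ∘ₗ Submodule.subtype _
  have hf : Function.Injective f := by
    rw [← LinearMap.ker_eq_bot, LinearMap.ker_eq_bot']
    rintro ⟨w, hw⟩ h0
    have hz : ∀ l, l ≠ i → l ≠ j → w l = 0 := fun l h1 h2 =>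
      congrFun h0 ⟨l, by simp [h1, h2]⟩
    have hw' : ∀ l, w i * C i l + w j * C j l = 0 := by
      intro l
      have := congrFun (show w ᵥ* C = 0 from hw) l
      rwa [Matrix.vecMul, dotProduct,
        Fintype.sum_eq_add i j hne (fun x hx => by rw [hz x hx.1 hx.2, zero_mul])] at this
    have hi : w i = 0 := by simpa [hdiag, hij] using hw' j
    have hj : w j = 0 := by simpa [hdiag, hji] using hw' i
    refine Subtype.ext (funext fun l => ?_)
    by_cases h1 : l = i
    · simpa [h1] using hi
    by_cases h2 : l = j
    · simpa [h2] using hj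
    exact hz l h1 h2
  refine (LinearMap.finrank_le_finrank_of_injective hf).trans_eq ?_
  rw [Module.finrank_fintype_fun_eq_card, Fintype.card_coe, Finset.card_compl,
    Finset.card_pair hne]

end LinearAlgebra

theorem exists_matrix_of_mem_formSpace {F : Type} [Field F] {k Q : ℕ}
    {p : MvPolynomial (Fin k) F} (hp : p ∈ formSpace F k Q) :
    ∃ C : Matrix (Fin k) (Fin k) F, (∀ i, C i i = 0) ∧ (∀ i j, C i j = -C j i) ∧
      p = ∑ i, ∑ j, MvPolynomial.C (C i j) * (X i ^ Q * X j) := by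
  induction hp using Submodule.span_induction with
  | mem p hp =>
    obtain ⟨i, j, hij, rfl⟩ := hp
    refine ⟨Matrix.single i j 1 - Matrix.single j i 1, ?_, ?_, ?_⟩
    · intro l
      simp only [Matrix.sub_apply, Matrix.single_apply]
      grind
    · intro a b
      simp only [Matrix.sub_apply, Matrix.single_apply]
      grind
    · simp only [Matrix.sub_apply, map_sub, sub_mul, Finset.sum_sub_distrib, Matrix.single_apply,
        apply_ite MvPolynomial.C, map_zero, map_one, ite_mul, zero_mul, one_mul, ite_and]
      simp [mul_comm]
  | zero => exact ⟨0, by simp⟩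
  | add p₁ p₂ _ _ h₁ h₂ =>
    obtain ⟨C₁, hd₁, hs₁, rfl⟩ := h₁
    obtain ⟨C₂, hd₂, hs₂, rfl⟩ := h₂
    refine ⟨C₁ + C₂, fun i => by simp [hd₁, hd₂], fun i j => ?_, ?_⟩
    · rw [Matrix.add_apply, hs₁, hs₂, Matrix.add_apply]; ring
    · simp [add_mul, Finset.sum_add_distrib]
  | smul c p _ h =>
    obtain ⟨C, hd, hs, rfl⟩ := h
    refine ⟨c • C, fun i => by simp [hd], fun i j => ?_, ?_⟩
    · rw [Matrix.smul_apply, hs, Matrix.smul_apply, smul_neg]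
    · simp [MvPolynomial.smul_eq_C_mul, Finset.mul_sum, mul_assoc]

open Matrix in
theorem Matrix.dotProduct_mulVec_self_of_isAlt {ι R : Type*} [Fintype ι] [CommRing R]
    {C : Matrix ι ι R} (hdiag : ∀ i, C i i = 0) (hskew : ∀ i j, C i j = -C j i) (x : ι → R) :
    x ⬝ᵥ (C *ᵥ x) = 0 := by
  classical
  simp only [dotProduct, Matrix.mulVec, Finset.mul_sum]
  rw [← Finset.sum_product']
  refine Finset.sum_involution (fun a _ => (a.2, a.1)) ?_ ?_ (by simp) (by simp)
  · rintro ⟨i, j⟩ -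
    simp only [hskew i j]
    ring
  · rintro ⟨i, j⟩ - h he
    obtain rfl : j = i := congrArg Prod.fst he
    simp [hdiag] at h

section Ztilde

variable {K F : Type} [Field K] [Finite K] [Field F] [Algebra K F] [FiniteDimensional K F]
  {k Q : ℕ}

open Matrix in
/-- For a form `p` with alternating matrix `C`, the set `Z̃_p` consists of the vectors in the
kernel of `C` all of whose coordinates have trace zero. -/
theorem mem_Ztilde_iff (σ : F ≃ₐ[K] F) (hσQ : ∀ x, σ x = x ^ Q)
    (hσ : ∀ x, σ x = x → x ∈ Set.range (algebraMap K F))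
    {C : Matrix (Fin k) (Fin k) F} (hdiag : ∀ i, C i i = 0) (hskew : ∀ i j, C i j = -C j i)
    (w : Fin k → F) :
    w ∈ Ztilde K F Q (∑ i, ∑ j, MvPolynomial.C (C i j) * (X i ^ Q * X j)) ↔
      w ᵥ* C = 0 ∧ ∀ j, Algebra.trace K F (w j) = 0 := by
  have hrange := FiniteField.range_sub_id_eq_ker_trace σ hσ
  have heval : ∀ (α : Fin k → F) (a : Fin k → K),
      eval (α + fun i => algebraMap K F (a i))
        (∑ i, ∑ j, MvPolynomial.C (C i j) * (X i ^ Q * X j)) =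
      ((fun j => α j ^ Q - α j) ᵥ* C) ⬝ᵥ (α + fun i => algebraMap K F (a i)) := by
    intro α a
    set v : Fin k → F := α + fun i => algebraMap K F (a i) with hv
    have h1 : (fun j => α j ^ Q - α j) = (fun j => v j ^ Q) - v := by
      funext j
      simp [hv, ← hσQ]
    rw [h1, ← Matrix.dotProduct_mulVec, sub_dotProduct,
      Matrix.dotProduct_mulVec_self_of_isAlt hdiag hskew, sub_zero]
    simp only [map_sum, map_mul, map_pow, eval_C, eval_X, dotProduct, Matrix.mulVec,
      Finset.mul_sum]
    refine Finset.sum_congr rfl fun i _ => Finset.sum_congr rfl fun j _ => by ring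
  constructor
  · rintro ⟨α, hα, rfl⟩
    refine ⟨?_, fun j => ?_⟩
    · have h : ∀ a : Fin k → K, ((fun j => α j ^ Q - α j) ᵥ* C) ⬝ᵥ
          (α + fun i => algebraMap K F (a i)) = 0 :=
        fun a => (heval α a).symm.trans (hα _ ⟨a, rfl⟩)
      have h0 := h 0
      funext l
      have hl := h (Pi.single l 1)
      rw [dotProduct_add] at h0 hl
      have he : (fun i => algebraMap K F ((Pi.single l 1 : Fin k → K) i)) = Pi.single l 1 := by
        funext i
        by_cases h : i = l
        · subst h; simp
        · simp [h]
      rw [he, dotProduct_single_one] at hl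
      have hz : (fun i => algebraMap K F ((0 : Fin k → K) i)) = 0 := by
        funext i; simp
      rw [hz, dotProduct_zero, add_zero] at h0
      simpa [h0] using hl
    · have : σ (α j) - α j ∈ LinearMap.ker (Algebra.trace K F) := hrange ▸ ⟨α j, rfl⟩
      rwa [hσQ] at this
  · rintro ⟨hw, htr⟩
    have hex : ∀ j, ∃ x : F, σ x - x = w j := fun j => by
      have : w j ∈ LinearMap.range (σ.toLinearMap - LinearMap.id) := hrange ▸ htr j
      exact this
    choose α hα using hex
    have hwα : w = fun j => α j ^ Q - α j := funext fun j => by rw [← hσQ, hα]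
    refine ⟨α, ?_, hwα⟩
    rintro _ ⟨a, rfl⟩
    rw [heval, ← hwα, hw, zero_dotProduct]

theorem card_Ztilde_le {p : MvPolynomial (Fin k) F}
    (htr : ∀ w ∈ Ztilde K F Q p, ∀ j, Algebra.trace K F (w j) = 0) :
    Nat.card (Ztilde K F Q p) ≤ Nat.card K ^ ((Module.finrank K F - 1) *
      Module.finrank F (Submodule.span F (Ztilde K F Q p))) := by
  have : Finite F := Module.finite_of_finite K
  obtain ⟨s, hs, hinj⟩ := (Submodule.span F (Ztilde K F Q p)).exists_coordinates_injOn
  have hcard : Nat.card (LinearMap.ker (Algebra.trace K F)) =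
      Nat.card K ^ (Module.finrank K F - 1) := by
    rw [Module.natCard_eq_pow_finrank (K := K), ← FiniteField.finrank_ker_trace_add_one (K := K),
      Nat.add_sub_cancel]
  let f : Ztilde K F Q p → s → LinearMap.ker (Algebra.trace K F) :=
    fun w i => ⟨w.1 i, htr w.1 w.2 i⟩
  have hf : Function.Injective f := fun x y hxy => Subtype.ext <|
    hinj (Submodule.subset_span x.2) (Submodule.subset_span y.2) <|
      funext fun i => congrArg Subtype.val (congrFun hxy i)
  refine (Nat.card_le_card_of_injective f hf).trans ?_
  rw [Nat.card_fun, hcard, ← pow_mul]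
  exact Nat.pow_le_pow_right Nat.card_pos (Nat.mul_le_mul_left _ hs)

theorem pow_sum_finrank_traceKer_le_card_Ztilde {r : ℕ} {p : MvPolynomial (Fin k) F}
    {α : Fin r → Fin k → F} (hli : LinearIndependent F fun i j => α i j ^ Q - α i j)
    (hmem : ∀ v : Fin r → F, (∀ i, v i ∈ traceKer K F Q (α i)) →
      ∑ i, v i • (fun j => α i j ^ Q - α i j) ∈ Ztilde K F Q p) :
    Nat.card K ^ (∑ i, Module.finrank K (traceKer K F Q (α i))) ≤
      Nat.card (Ztilde K F Q p) := by
  have : Finite F := Module.finite_of_finite K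
  let f : (∀ i, traceKer K F Q (α i)) → Ztilde K F Q p :=
    fun v => ⟨_, hmem (fun i => (v i).1) fun i => (v i).2⟩
  have hf : Function.Injective f := fun x y hxy => funext fun i => Subtype.ext <|
    congrFun (hli.fintypeLinearCombination_injective (congrArg Subtype.val hxy)) i
  refine le_of_eq_of_le ?_ (Nat.card_le_card_of_injective f hf)
  rw [Nat.card_pi, ← Finset.prod_pow_eq_pow_sum]
  exact Finset.prod_congr rfl fun i _ => (Module.natCard_eq_pow_finrank (K := K)).symm

end Ztilde

theorem mem_traceKer {K F : Type} [Field K] [Field F] [Algebra K F] {k Q : ℕ} {α : Fin k → F}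
    {v : F} : v ∈ traceKer K F Q α ↔
      ∀ j, Algebra.trace K F ((α j ^ Q - α j) * v) = 0 := by
  simp [traceKer]

theorem statement_16
    (q m k s δ : ℕ) (hqp : IsPrimePow q) (hm : 0 < m) (hk : 2 ≤ k)
    (hs1 : 1 ≤ s) (hs2 : s ≤ m - 1) (hδ : δ = Nat.gcd s m)
    (Fq Fqd Fqm : Type) [Field Fq] [Fintype Fq] [Field Fqd] [Field Fqm]
    [Algebra Fq Fqd] [Algebra Fqd Fqm] [Algebra Fq Fqm] [IsScalarTower Fq Fqd Fqm]
    (hq : Fintype.card Fq = q)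
    (hd : Module.finrank Fq Fqd = δ) (hdeg : Module.finrank Fq Fqm = m)
    (p : MvPolynomial (Fin k) Fqm) (hp : p ∈ formSpace Fqm k (q ^ s)) (hp0 : p ≠ 0)
    (r : ℕ)
    (hr : Module.finrank Fqm ↥(Submodule.span Fqm (Ztilde Fqd Fqm (q ^ s) p)) = r) :
    (∃ α : Fin r → Fin k → Fqm,
      (q ^ δ) ^ (∑ i : Fin r, Module.finrank Fqd ↥(traceKer Fqd Fqm (q ^ s) (α i)))
          ≤ Nat.card (Ztilde Fqd Fqm (q ^ s) p) ∧
        Nat.card (Ztilde Fqd Fqm (q ^ s) p) ≤ q ^ (r * (m - δ))) ∧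
      Nat.card (Ztilde Fqd Fqm (q ^ s) p) ≤ q ^ ((k - 2) * (m - δ)) := by
  subst hδ
  have hδ0 : 0 < Nat.gcd s m := Nat.gcd_pos_of_pos_left _ hs1
  have : Module.Finite Fq Fqm := Module.finite_of_finrank_pos (hdeg ▸ hm)
  have : Module.Finite Fq Fqd := Module.finite_of_finrank_pos (hd ▸ hδ0)
  have : Module.Finite Fqd Fqm := Module.Finite.of_restrictScalars_finite Fq Fqd Fqm
  have : Finite Fqd := Module.finite_of_finite Fq
  have : Finite Fqm := Module.finite_of_finite Fq
  have := Fintype.ofFinite Fqd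
  have := Fintype.ofFinite Fqm
  have hcard : Nat.card Fqd = q ^ Nat.gcd s m := by
    rw [Module.natCard_eq_pow_finrank (K := Fq), hd, Nat.card_eq_fintype_card, hq]
  have hcardm : Fintype.card Fqm = q ^ m := by
    rw [Module.card_eq_pow_finrank (K := Fq), hdeg, hq]
  have hn : Nat.gcd s m * Module.finrank Fqd Fqm = m := by
    rw [← hd, ← hdeg, Module.finrank_mul_finrank]
  obtain ⟨t, ht⟩ := Nat.gcd_dvd_left s m
  let σ : Fqm ≃ₐ[Fqd] Fqm := FiniteField.frobeniusAlgEquivOfAlgebraic Fqd Fqm ^ t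
  have hσQ : ∀ x, σ x = x ^ q ^ s := by
    intro x
    simp only [σ, AlgEquiv.coe_pow, FiniteField.coe_frobeniusAlgEquivOfAlgebraic, pow_iterate]
    rw [← Nat.card_eq_fintype_card, hcard, ← pow_mul, ← ht]
  have hσ : ∀ x, σ x = x → x ∈ Set.range (algebraMap Fqd Fqm) := by
    intro x hx
    apply FiniteField.mem_range_algebraMap_of_pow_card_eq
    have h1 : Function.IsPeriodicPt (fun y : Fqm => y ^ q) s x := by
      rw [Function.IsPeriodicPt, Function.IsFixedPt, pow_iterate]
      exact (hσQ x).symm.trans hx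
    have h2 : Function.IsPeriodicPt (fun y : Fqm => y ^ q) m x := by
      rw [Function.IsPeriodicPt, Function.IsFixedPt, pow_iterate]
      exact hcardm ▸ FiniteField.pow_card x
    have h3 := h1.gcd h2
    rwa [Function.IsPeriodicPt, Function.IsFixedPt, pow_iterate, ← hcard] at h3
  obtain ⟨C, hdiag, hskew, hpC⟩ := exists_matrix_of_mem_formSpace hp
  have hC : C ≠ 0 := by
    rintro rfl
    exact hp0 (by simp [hpC])
  have hZ := mem_Ztilde_iff σ hσQ hσ hdiag hskew
  rw [← hpC] at hZ
  have hupper : Nat.card (Ztilde Fqd Fqm (q ^ s) p) ≤ q ^ (r * (m - Nat.gcd s m)) := by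
    refine (card_Ztilde_le fun w hw => ((hZ w).1 hw).2).trans_eq ?_
    rw [hr, hcard, ← pow_mul, ← mul_assoc, Nat.mul_sub, hn, mul_one, mul_comm]
  have hr2 : r ≤ k - 2 := by
    rw [← hr]
    refine (Submodule.finrank_mono (Submodule.span_le.2 fun w hw => ?_)).trans
      ((Matrix.finrank_ker_vecMulLinear_le_of_isAlt hC hdiag hskew).trans_eq
        (by rw [Fintype.card_fin]))
    exact ((hZ w).1 hw).1
  refine ⟨?_, hupper.trans (Nat.pow_le_pow_right (hq ▸ Fintype.card_pos)
    (Nat.mul_le_mul_right _ hr2))⟩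
  subst hr
  obtain ⟨β, hβ, -, hli⟩ :=
    Submodule.exists_fun_fin_finrank_span_eq Fqm (Ztilde Fqd Fqm (q ^ s) p)
  choose α hα hαβ using hβ
  refine ⟨α, ?_, hupper⟩
  rw [← hcard]
  refine pow_sum_finrank_traceKer_le_card_Ztilde (by rwa [← funext hαβ]) fun v hv => ?_
  simp only [← hαβ]
  refine (hZ _).2 ⟨?_, fun j => ?_⟩
  · rw [Matrix.sum_vecMul]
    refine Finset.sum_eq_zero fun i _ => ?_
    rw [Matrix.smul_vecMul, ((hZ (β i)).1 ⟨α i, hα i, hαβ i⟩).1, smul_zero]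
  · rw [Finset.sum_apply, map_sum]
    refine Finset.sum_eq_zero fun i _ => ?_
    rw [Pi.smul_apply, smul_eq_mul, mul_comm, hαβ]
    exact mem_traceKer.1 (hv i) j
end
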